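/- Let d>0 and Δ₁, Δ₂ be real with h/2 < Δ₊ < 3h/2, where h=d/2, Δ₊=(Δ₁+Δ₂)/2, Δ₋=(Δ₁−Δ₂)/2. Then for all purely imaginary α, β, both integrals below converge absolutely and the crosscap duality relation C(α,β|Δ₁,Δ₂) = C(β,α|d−Δ₂,d−Δ₁) holds, where C(α,β|Δ₁,Δ₂) = ∫₀¹ w_proj(η)·(η/(1−η))^{Δ₊}·Φ_α(η)·Φ_β(1−η) dη; note that the replacement (Δ₁,Δ₂)→(d−Δ₂,d−Δ₁) leaves Δ₋, and hence the crosscap partial waves Φ, unchanged while replacing Δ₊ by d−Δ₊. -/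

import Mathlib

open scoped Real
open Complex MeasureTheory Set ComplexConjugate

noncomputable section

/-- Pochhammer symbol `(a)ₙ = a (a+1) ⋯ (a+n−1)`. -/
def poch (a : ℂ) (n : ℕ) : ℂ := (ascPochhammer ℂ n).eval a

/-- Gauss hypergeometric series `₂F₁(a,b;c;z)`. -/
def hyp2F1 (a b c z : ℂ) : ℂ :=
  ∑' n : ℕ, poch a n * poch b n / (poch c n * (n.factorial : ℂ)) * z ^ n

/-- Jacobi function `ϑ_α^{(p,q)}(x)` on `0 < x < 1`. -/
def thetaJ (p q α : ℂ) (x : ℝ) : ℂ :=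
  (x : ℂ) ^ ((1 + p + q) / 2 + α) *
    hyp2F1 ((1 + p + q) / 2 + α) ((1 + p - q) / 2 + α) (1 + p) (1 - (x : ℂ))

/-- The crosscap partial wave `Φ_α(η) = η^{−Δ₋} ϑ_α^{(h−1, 2Δ₋)}(η)`. -/
def Phi (h Δm : ℝ) (α : ℂ) (η : ℝ) : ℂ :=
  (η : ℂ) ^ ((-Δm : ℝ) : ℂ) * thetaJ ((h - 1 : ℝ) : ℂ) ((2 * Δm : ℝ) : ℂ) α η

/-- The crosscap weight `w_proj(η) = (1−η)^{h−1} η^{−h−1}`. -/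
def wproj (h : ℝ) (η : ℝ) : ℂ :=
  ((1 - η : ℝ) : ℂ) ^ ((h - 1 : ℝ) : ℂ) * (η : ℂ) ^ ((-h - 1 : ℝ) : ℂ)

open Filter Topology

theorem poch_eq_prod (a : ℂ) (n : ℕ) : poch a n = ∏ j ∈ Finset.range n, (a + j) := by
  induction n with
  | zero => simp [poch]
  | succ n ih => rw [Finset.prod_range_succ, ← ih, poch, ascPochhammer_succ_eval, poch]

theorem poch_succ_eq_mul_inv_GammaSeq (a : ℂ) {n : ℕ} (hn : n ≠ 0) :
    poch a (n + 1) = (n : ℂ) ^ a * n.factorial * (GammaSeq a n)⁻¹ := by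
  have h1 : (n : ℂ) ^ a ≠ 0 := by simp [cpow_eq_zero_iff, hn]
  have h2 : (n.factorial : ℂ) ≠ 0 := by exact_mod_cast n.factorial_ne_zero
  rw [GammaSeq, poch_eq_prod]
  field_simp

theorem norm_natCast_cpow_mul_factorial (a : ℂ) {n : ℕ} (hn : n ≠ 0) :
    ‖(n : ℂ) ^ a * n.factorial‖ = (n : ℝ) ^ a.re * n.factorial := by
  rw [norm_mul, norm_natCast_cpow_of_pos (Nat.pos_of_ne_zero hn), norm_natCast]

theorem exists_norm_poch_succ_le (a : ℂ) : ∃ C : ℝ, 0 ≤ C ∧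
    ∀ᶠ n : ℕ in atTop, ‖poch a (n + 1)‖ ≤ C * ((n : ℝ) ^ a.re * n.factorial) := by
  by_cases ha : ∃ m : ℕ, a = -m
  · obtain ⟨m, rfl⟩ := ha
    refine ⟨0, le_rfl, ?_⟩
    filter_upwards [eventually_ge_atTop m] with n hn
    rw [poch, ascPochhammer_eval_neg_coe_nat_of_lt (by lia)]
    simp
  · have hΓ : Gamma a ≠ 0 := fun h => ha ((Gamma_eq_zero_iff a).1 h)
    have ht := ((GammaSeq_tendsto_Gamma a).inv₀ hΓ).norm
    refine ⟨‖(Gamma a)⁻¹‖ + 1, by positivity, ?_⟩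
    filter_upwards [ht.eventually_le_const (lt_add_one _), eventually_ne_atTop 0] with n hn h0
    rw [poch_succ_eq_mul_inv_GammaSeq a h0, norm_mul, norm_natCast_cpow_mul_factorial a h0,
      mul_comm]
    gcongr

theorem exists_le_norm_poch_succ (c : ℂ) (hc : ∀ m : ℕ, c ≠ -m) : ∃ C : ℝ, 0 < C ∧
    ∀ᶠ n : ℕ in atTop, (n : ℝ) ^ c.re * n.factorial ≤ C * ‖poch c (n + 1)‖ := by
  have ht := (GammaSeq_tendsto_Gamma c).norm
  refine ⟨‖Gamma c‖ + 1, by positivity, ?_⟩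
  filter_upwards [ht.eventually_le_const (lt_add_one _), eventually_ne_atTop 0] with n hn h0
  have hne : GammaSeq c n ≠ 0 := by
    rw [GammaSeq]
    refine div_ne_zero (mul_ne_zero (by simp [cpow_eq_zero_iff, h0])
      (by exact_mod_cast n.factorial_ne_zero)) (Finset.prod_ne_zero_iff.2 fun j _ h => ?_)
    exact hc j (eq_neg_of_add_eq_zero_left h)
  rw [← norm_natCast_cpow_mul_factorial c h0]
  calc ‖(n : ℂ) ^ c * n.factorial‖ = ‖GammaSeq c n‖ * ‖poch c (n + 1)‖ := by
        rw [← norm_mul, poch_succ_eq_mul_inv_GammaSeq c h0]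
        congr 1
        field_simp
    _ ≤ _ := by gcongr

/-- The `n`-th coefficient of the Gauss hypergeometric series. -/
def hypCoeff (a b c : ℂ) (n : ℕ) : ℂ := poch a n * poch b n / (poch c n * (n.factorial : ℂ))

theorem exists_norm_hypCoeff_succ_le {a b c : ℂ} (hc : ∀ m : ℕ, c ≠ -m)
    (habc : a.re + b.re = c.re) :
    ∃ C : ℝ, 0 ≤ C ∧ ∀ n : ℕ, ‖hypCoeff a b c (n + 1)‖ ≤ C / (n + 1) := by
  obtain ⟨A, hA, ha⟩ := exists_norm_poch_succ_le a
  obtain ⟨B, hB, hb⟩ := exists_norm_poch_succ_le b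
  obtain ⟨D, hD, hd⟩ := exists_le_norm_poch_succ c hc
  have hO : (fun n : ℕ => hypCoeff a b c (n + 1)) =O[atTop] fun n : ℕ => (1 : ℝ) / (n + 1) := by
    refine Asymptotics.IsBigO.of_bound (A * B * D) ?_
    filter_upwards [ha, hb, hd, eventually_gt_atTop 0] with n ha hb hd hn
    have hn' : (0 : ℝ) < n := by exact_mod_cast hn
    have hf : (0 : ℝ) < n.factorial := by exact_mod_cast n.factorial_pos
    have hpc : 0 < ‖poch c (n + 1)‖ := by
      have : 0 < (n : ℝ) ^ c.re * n.factorial := by positivity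
      exact pos_of_mul_pos_right (this.trans_le hd) hD.le
    rw [hypCoeff, norm_div, norm_mul, norm_mul, norm_natCast, Nat.factorial_succ,
      Real.norm_of_nonneg (by positivity), div_le_iff₀ (by positivity)]
    push_cast
    calc ‖poch a (n + 1)‖ * ‖poch b (n + 1)‖
        ≤ (A * ((n : ℝ) ^ a.re * n.factorial)) * (B * ((n : ℝ) ^ b.re * n.factorial)) := by gcongr
      _ = A * B * n.factorial * ((n : ℝ) ^ c.re * n.factorial) := by
        rw [← habc, Real.rpow_add hn']; ring
      _ ≤ A * B * n.factorial * (D * ‖poch c (n + 1)‖) := by gcongr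
      _ = _ := by field_simp
  obtain ⟨C, hC, h⟩ := Asymptotics.bound_of_isBigO_nat_atTop hO
  refine ⟨C, hC.le, fun n => ?_⟩
  have hn : (0 : ℝ) < (n : ℝ) + 1 := by positivity
  have := h (x := n) (by positivity)
  rwa [Real.norm_of_nonneg (by positivity), mul_one_div] at this

theorem hypCoeff_zero (a b c : ℂ) : hypCoeff a b c 0 = 1 := by simp [hypCoeff, poch]

theorem exists_hasSum_majorant {a b c : ℂ} (hc : ∀ m : ℕ, c ≠ -m) (habc : a.re + b.re = c.re) :
    ∃ C : ℝ, 0 ≤ C ∧ ∀ z : ℝ, 0 ≤ z → z < 1 → ∃ g : ℕ → ℝ, HasSum g (1 - C * Real.log (1 - z)) ∧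
      ∀ n, ‖hypCoeff a b c n * (z : ℂ) ^ n‖ ≤ g n := by
  obtain ⟨C, hC, h⟩ := exists_norm_hypCoeff_succ_le hc habc
  refine ⟨C, hC, fun z hz hz1 => ?_⟩
  have hs := (Real.hasSum_pow_div_log_of_abs_lt_one (x := z)
    (by rwa [abs_of_nonneg hz])).mul_left C
  refine ⟨fun n => n.casesOn 1 fun n => C * (z ^ (n + 1) / (n + 1)), ?_, fun n => ?_⟩
  · rw [← hasSum_nat_add_iff' 1]
    simpa using hs
  · cases n with
    | zero => simp [hypCoeff_zero]
    | succ n =>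
      rw [norm_mul, norm_pow, norm_real, Real.norm_of_nonneg hz]
      calc _ ≤ C / (n + 1) * z ^ (n + 1) := by gcongr; exact h n
        _ = _ := by ring

theorem exists_norm_hyp2F1_le {a b c : ℂ} (hc : ∀ m : ℕ, c ≠ -m) (habc : a.re + b.re = c.re)
    {ε : ℝ} (hε : 0 < ε) :
    ∃ K : ℝ, 0 ≤ K ∧ ∀ x : ℝ, 0 < x → x ≤ 1 → ‖hyp2F1 a b c (1 - x)‖ ≤ K * x ^ (-ε) := by
  obtain ⟨C, hC, h⟩ := exists_hasSum_majorant hc habc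
  refine ⟨1 + C / ε, by positivity, fun x hx hx1 => ?_⟩
  obtain ⟨g, hg, hle⟩ := h (1 - x) (by linarith) (by linarith)
  have h1 : 1 ≤ x ^ (-ε) := Real.one_le_rpow_of_pos_of_le_one_of_nonpos hx hx1 (by linarith)
  have h2 : -Real.log x ≤ x ^ (-ε) / ε := by
    have := Real.log_le_rpow_div (x := x⁻¹) (by positivity) hε
    rwa [Real.log_inv, Real.inv_rpow hx.le, ← Real.rpow_neg hx.le] at this
  calc ‖hyp2F1 a b c (1 - x)‖ ≤ 1 - C * Real.log (1 - (1 - x)) :=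
        tsum_of_norm_bounded hg fun n => by simpa [hypCoeff] using hle n
    _ = 1 + C * -Real.log x := by ring_nf
    _ ≤ x ^ (-ε) + C * (x ^ (-ε) / ε) := by gcongr
    _ = _ := by ring

theorem aestronglyMeasurable_hyp2F1 {a b c : ℂ} (hc : ∀ m : ℕ, c ≠ -m)
    (habc : a.re + b.re = c.re) :
    AEStronglyMeasurable (fun x : ℝ => hyp2F1 a b c (1 - x)) (volume.restrict (Ioo 0 1)) := by
  obtain ⟨C, hC, h⟩ := exists_hasSum_majorant hc habc
  refine aestronglyMeasurable_of_tendsto_ae atTop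
    (f := fun (N : ℕ) (x : ℝ) => ∑ n ∈ Finset.range N, hypCoeff a b c n * (1 - (x : ℂ)) ^ n)
    (fun N => (by fun_prop : Continuous _).aestronglyMeasurable) ?_
  filter_upwards [ae_restrict_mem measurableSet_Ioo] with x hx
  obtain ⟨g, hg, hle⟩ := h (1 - x) (by linarith [hx.2]) (by linarith [hx.1])
  refine (Summable.of_norm_bounded hg.summable fun n => ?_).hasSum.tendsto_sum_nat
  simpa [hypCoeff] using hle n

theorem hypergeometric_c_ne {h : ℝ} (hh : 0 < h) (m : ℕ) : 1 + ((h - 1 : ℝ) : ℂ) ≠ -m := by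
  intro H
  have := congrArg re H
  simp at this
  linarith [(m.cast_nonneg : (0 : ℝ) ≤ m)]

theorem hypergeometric_re_add {α : ℂ} (hα : α.re = 0) (h m : ℝ) :
    ((1 + ((h - 1 : ℝ) : ℂ) + ((2 * m : ℝ) : ℂ)) / 2 + α).re +
      ((1 + ((h - 1 : ℝ) : ℂ) - ((2 * m : ℝ) : ℂ)) / 2 + α).re =
      (1 + ((h - 1 : ℝ) : ℂ)).re := by
  simp [hα]
  ring

theorem exists_norm_Phi_le {h : ℝ} (hh : 0 < h) (m : ℝ) {α : ℂ} (hα : α.re = 0)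
    {ε : ℝ} (hε : 0 < ε) :
    ∃ K : ℝ, 0 ≤ K ∧ ∀ x : ℝ, 0 < x → x ≤ 1 → ‖Phi h m α x‖ ≤ K * x ^ (h / 2 - ε) := by
  obtain ⟨K, hK, hF⟩ := exists_norm_hyp2F1_le (hypergeometric_c_ne hh)
    (hypergeometric_re_add hα h m) hε
  refine ⟨K, hK, fun x hx hx1 => ?_⟩
  rw [Phi, thetaJ, norm_mul, norm_mul, norm_cpow_eq_rpow_re_of_pos hx,
    norm_cpow_eq_rpow_re_of_pos hx]
  calc _ ≤ x ^ (((-m : ℝ) : ℂ)).re *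
        (x ^ ((1 + ((h - 1 : ℝ) : ℂ) + ((2 * m : ℝ) : ℂ)) / 2 + α).re * (K * x ^ (-ε))) := by
        gcongr
        exact hF x hx hx1
    _ = K * (x ^ (((-m : ℝ) : ℂ)).re *
        x ^ ((1 + ((h - 1 : ℝ) : ℂ) + ((2 * m : ℝ) : ℂ)) / 2 + α).re * x ^ (-ε)) := by ring
    _ = _ := by
        rw [← Real.rpow_add hx, ← Real.rpow_add hx]
        congr 2
        simp [hα]
        ring

theorem aestronglyMeasurable_Phi {h : ℝ} (hh : 0 < h) (m : ℝ) {α : ℂ} (hα : α.re = 0) :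
    AEStronglyMeasurable (Phi h m α) (volume.restrict (Ioo 0 1)) := by
  have hF := aestronglyMeasurable_hyp2F1 (hypergeometric_c_ne hh) (hypergeometric_re_add hα h m)
  have hp (s : ℂ) : AEStronglyMeasurable (fun x : ℝ => (x : ℂ) ^ s)
      (volume.restrict (Ioo 0 1)) :=
    (measurable_ofReal.pow_const s).aestronglyMeasurable
  exact (hp _).mul ((hp _).mul hF)

theorem measurePreserving_one_sub_Ioo :
    MeasurePreserving (fun x : ℝ => 1 - x) (volume.restrict (Ioo 0 1))
      (volume.restrict (Ioo 0 1)) := by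
  have := (Measure.measurePreserving_sub_left (volume : Measure ℝ) 1).restrict_preimage
    (measurableSet_Ioo (a := (0 : ℝ)) (b := 1))
  simpa using this

/-- On `(0, 1)` the full weight of the crosscap pairing is `η^{s-h-1} (1-η)^{h-1-s}`. -/
theorem wproj_mul_cpow (h s : ℝ) {x : ℝ} (hx : x ∈ Ioo (0 : ℝ) 1) :
    wproj h x * ((x / (1 - x) : ℝ) : ℂ) ^ (s : ℂ) =
      ((x ^ (s - h - 1) * (1 - x) ^ (h - 1 - s) : ℝ) : ℂ) := by
  have h0 : 0 < x := hx.1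
  have h1 : 0 < 1 - x := sub_pos.2 hx.2
  rw [wproj, ← ofReal_cpow h1.le, ← ofReal_cpow h0.le, ← ofReal_cpow (by positivity),
    ← ofReal_mul, ← ofReal_mul, Real.div_rpow h0.le h1.le]
  congr 1
  rw [show s - h - 1 = (-h - 1) + s by ring, Real.rpow_add h0, Real.rpow_sub h1 (h - 1) s]
  ring

theorem integrableOn_beta {u v : ℝ} (hu : 0 < u) (hv : 0 < v) :
    IntegrableOn (fun x : ℝ => x ^ (u - 1) * (1 - x) ^ (v - 1)) (Ioo 0 1) := by
  have h := betaIntegral_convergent (u := u) (v := v) (by simpa) (by simpa)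
  rw [intervalIntegrable_iff_integrableOn_Ioo_of_le zero_le_one] at h
  refine IntegrableOn.congr_fun h.norm (fun x hx => ?_) measurableSet_Ioo
  have h0 : 0 < x := hx.1
  have h1 : 0 < 1 - x := sub_pos.2 hx.2
  have h2 : (1 : ℂ) - x = ((1 - x : ℝ) : ℂ) := by push_cast; rfl
  simp only [norm_mul, h2, norm_cpow_eq_rpow_re_of_pos h0, norm_cpow_eq_rpow_re_of_pos h1,
    sub_re, ofReal_re, one_re]

theorem integrableOn_crosscap {h s : ℝ} (m : ℝ) {α β : ℂ} (hh : 0 < h) (h1 : h / 2 < s)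
    (h2 : s < 3 * h / 2) (hα : α.re = 0) (hβ : β.re = 0) :
    IntegrableOn (fun x : ℝ => wproj h x * ((x / (1 - x) : ℝ) : ℂ) ^ (s : ℂ) *
      Phi h m α x * Phi h m β (1 - x)) (Ioo 0 1) := by
  obtain ⟨ε, hε, hεs⟩ := exists_between (lt_min (sub_pos.2 h1) (sub_pos.2 h2))
  obtain ⟨hε1, hε2⟩ := lt_min_iff.1 hεs
  obtain ⟨K, hK, hKα⟩ := exists_norm_Phi_le hh m hα hε
  obtain ⟨L, hL, hLβ⟩ := exists_norm_Phi_le hh m hβ hε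
  have hI := (integrableOn_beta (u := s - h / 2 - ε) (v := 3 * h / 2 - s - ε)
    (by linarith) (by linarith)).const_mul (K * L)
  refine Integrable.mono' hI ?_ ?_
  · have hw : Measurable fun x : ℝ => wproj h x * ((x / (1 - x) : ℝ) : ℂ) ^ (s : ℂ) := by
      unfold wproj
      fun_prop
    exact (hw.aestronglyMeasurable.mul (aestronglyMeasurable_Phi hh m hα)).mul
      ((aestronglyMeasurable_Phi hh m hβ).comp_measurePreserving measurePreserving_one_sub_Ioo)
  · filter_upwards [ae_restrict_mem measurableSet_Ioo] with x hx
    have h0 : 0 < x := hx.1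
    have h1 : 0 < 1 - x := sub_pos.2 hx.2
    rw [wproj_mul_cpow h s hx, norm_mul, norm_mul, norm_real, Real.norm_of_nonneg (by positivity)]
    calc _ ≤ x ^ (s - h - 1) * (1 - x) ^ (h - 1 - s) * (K * x ^ (h / 2 - ε)) *
          (L * (1 - x) ^ (h / 2 - ε)) := by
          gcongr
          · exact hKα x h0 hx.2.le
          · exact hLβ (1 - x) h1 (by linarith)
      _ = K * L * ((x ^ (s - h - 1) * x ^ (h / 2 - ε)) *
          ((1 - x) ^ (h - 1 - s) * (1 - x) ^ (h / 2 - ε))) := by ring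
      _ = _ := by
          rw [← Real.rpow_add h0, ← Real.rpow_add h1]
          ring_nf

theorem stmt15 (d Δ₁ Δ₂ h Δp Δm : ℝ)
    (hh : h = d / 2) (hΔp : Δp = (Δ₁ + Δ₂) / 2) (hΔm : Δm = (Δ₁ - Δ₂) / 2)
    (hd : 0 < d) (h1 : h / 2 < Δp) (h2 : Δp < 3 * h / 2)
    (α β : ℂ) (hα : α.re = 0) (hβ : β.re = 0) :
    IntegrableOn (fun η : ℝ =>
        wproj h η * ((η / (1 - η) : ℝ) : ℂ) ^ ((Δp : ℝ) : ℂ) *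
          Phi h Δm α η * Phi h Δm β (1 - η)) (Ioo 0 1) ∧
    IntegrableOn (fun η : ℝ =>
        wproj h η * ((η / (1 - η) : ℝ) : ℂ) ^ ((d - Δp : ℝ) : ℂ) *
          Phi h Δm β η * Phi h Δm α (1 - η)) (Ioo 0 1) ∧
    ∫ η in Ioo (0 : ℝ) 1,
        wproj h η * ((η / (1 - η) : ℝ) : ℂ) ^ ((Δp : ℝ) : ℂ) *
          Phi h Δm α η * Phi h Δm β (1 - η)
      = ∫ η in Ioo (0 : ℝ) 1,
          wproj h η * ((η / (1 - η) : ℝ) : ℂ) ^ ((d - Δp : ℝ) : ℂ) *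
            Phi h Δm β η * Phi h Δm α (1 - η) := by
  have hh0 : 0 < h := by linarith
  refine ⟨integrableOn_crosscap Δm hh0 h1 h2 hα hβ,
    integrableOn_crosscap Δm hh0 (by linarith) (by linarith) hβ hα, ?_⟩
  have hemb : MeasurableEmbedding fun x : ℝ => 1 - x :=
    (Homeomorph.subLeft (1 : ℝ)).measurableEmbedding
  rw [← measurePreserving_one_sub_Ioo.integral_comp hemb]
  refine setIntegral_congr_fun measurableSet_Ioo fun x hx => ?_
  have hx' : 1 - x ∈ Ioo (0 : ℝ) 1 := ⟨by linarith [hx.2], by linarith [hx.1]⟩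
  have hw := wproj_mul_cpow h Δp hx'
  rw [sub_sub_cancel] at hw
  simp only [sub_sub_cancel, hw, wproj_mul_cpow _ _ hx]
  rw [show d - Δp - h - 1 = h - 1 - Δp by linarith, show h - 1 - (d - Δp) = Δp - h - 1 by linarith,
    mul_comm (x ^ _)]
  ring
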